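/- Suppose the linear operators 𝒜₁,…,𝒜ₛ : ℝ^{n×n} → ℝ^m satisfy the ARIP at rank 2r with parameter δ₂ᵣ and at rank 3r with parameter δ₃ᵣ (δ₂ᵣ ≤ δ₃ᵣ < 1). Let X₁,…,Xₛ ∈ ℝ^{n×n} have rank exactly r, set σ_max = max_k σ_max(X_k), σ_min = min_k σ_min(X_k), and γ₂ = 2(2δ₂ᵣ/(1−δ₂ᵣ) + δ₃ᵣ/(1−δ₂ᵣ) + 2δ₃ᵣ√(rs)·σ_max/σ_min). Let y = Σ_{k=1}^s 𝒜_k(X_k), and consider the FIHT iterates: X_{k,0} is a best rank-r approximation of 𝒜_k^*(y), and for l ≥ 0 (assuming each X_{k,l} has rank r and P_{T_{k,l}}(G_{k,l}) ≠ 0), r_l = y − Σ_k 𝒜_k(X_{k,l}), G_{k,l} = 𝒜_k^*(r_l), α_{k,l} = ‖P_{T_{k,l}}(G_{k,l})‖_F² / ‖𝒜_k(P_{T_{k,l}}(G_{k,l}))‖², and X_{k,l+1} is a best rank-r approximation of X_{k,l} + α_{k,l} P_{T_{k,l}}(G_{k,l}). If γ₂ < 1, then for every l ≥ 0, √(Σ_{k=1}^s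 ‖X_{k,l+1} − X_k‖_F²) ≤ γ₂ · √(Σ_{k=1}^s ‖X_{k,l} − X_k‖_F²). -/

import Mathlib

open Matrix MeasureTheory ProbabilityTheory Finset

noncomputable section

/-- Frobenius inner product on square real matrices: `⟨X,Y⟩ = trace (Xᵀ Y)`. -/
def finner {n : ℕ} (X Y : Matrix (Fin n) (Fin n) ℝ) : ℝ := (Xᵀ * Y).trace

/-- Frobenius norm. -/
def fnorm {n : ℕ} (X : Matrix (Fin n) (Fin n) ℝ) : ℝ := Real.sqrt (finner X X)

/-- Euclidean norm on `ℝ^m`. -/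
def enorm2 {m : ℕ} (v : Fin m → ℝ) : ℝ := Real.sqrt (∑ p, (v p) ^ 2)

/-- The linear operator `𝒜` associated with measurement matrices `A_p`:
`(𝒜 Z)_p = (1/√m) ⟨A_p, Z⟩`. -/
def opA {n m : ℕ} (A : Fin m → Matrix (Fin n) (Fin n) ℝ)
    (Z : Matrix (Fin n) (Fin n) ℝ) : Fin m → ℝ :=
  fun p => (1 / Real.sqrt m) * finner (A p) Z

/-- The adjoint operator `𝒜^* v = (1/√m) Σ_p v_p A_p`. -/
def adjA {n m : ℕ} (A : Fin m → Matrix (Fin n) (Fin n) ℝ)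
    (v : Fin m → ℝ) : Matrix (Fin n) (Fin n) ℝ :=
  (1 / Real.sqrt m) • ∑ p, v p • A p

/-- Amalgam restricted isometry property at rank `r` with parameter `δ`. -/
def ARIP {n m s : ℕ} (𝒜 : Fin s → Matrix (Fin n) (Fin n) ℝ → (Fin m → ℝ))
    (r : ℕ) (δ : ℝ) : Prop :=
  ∀ Z : Fin s → Matrix (Fin n) (Fin n) ℝ, (∀ k, (Z k).rank ≤ r) →
    (1 - δ) * ∑ k, fnorm (Z k) ^ 2 ≤ enorm2 (∑ k, 𝒜 k (Z k)) ^ 2 ∧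
    enorm2 (∑ k, 𝒜 k (Z k)) ^ 2 ≤ (1 + δ) * ∑ k, fnorm (Z k) ^ 2

/-- Orthogonal projection onto the tangent space determined by the SVD factors `U`, `V`:
`P_T(G) = UUᵀG + GVVᵀ − UUᵀGVVᵀ`. -/
def Pt {n r : ℕ} (U V : Matrix (Fin n) (Fin r) ℝ)
    (G : Matrix (Fin n) (Fin n) ℝ) : Matrix (Fin n) (Fin n) ℝ :=
  U * Uᵀ * G + G * (V * Vᵀ) - U * Uᵀ * G * (V * Vᵀ)

/-- `X'` is a best rank-`r` approximation of `W` in Frobenius norm. -/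
def IsBestRankApprox {n : ℕ} (r : ℕ) (W X' : Matrix (Fin n) (Fin n) ℝ) : Prop :=
  X'.rank ≤ r ∧ ∀ Z : Matrix (Fin n) (Fin n) ℝ, Z.rank ≤ r → fnorm (X' - W) ≤ fnorm (Z - W)

def fr {a b : ℕ} (A : Matrix (Fin a) (Fin b) ℝ) : ℝ := (Aᵀ * A).trace

lemma finner_eq {n : ℕ} (X Y : Matrix (Fin n) (Fin n) ℝ) :
    finner X Y = ∑ i, ∑ j, X i j * Y i j := by
  unfold finner
  simp only [Matrix.trace, Matrix.diag, Matrix.mul_apply, Matrix.transpose_apply]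
  exact Finset.sum_comm

lemma fr_eq {a b : ℕ} (A : Matrix (Fin a) (Fin b) ℝ) : fr A = ∑ i, ∑ j, A i j ^ 2 := by
  unfold fr
  simp only [Matrix.trace, Matrix.diag, Matrix.mul_apply, Matrix.transpose_apply, ← pow_two]
  exact Finset.sum_comm

lemma fr_nonneg {a b : ℕ} (A : Matrix (Fin a) (Fin b) ℝ) : 0 ≤ fr A := by
  rw [fr_eq]; positivity

lemma fnorm_sq {n : ℕ} (X : Matrix (Fin n) (Fin n) ℝ) : fnorm X ^ 2 = fr X := by
  unfold fnorm
  rw [Real.sq_sqrt]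
  · rfl
  · exact fr_nonneg X

lemma fnorm_nonneg {n : ℕ} (X : Matrix (Fin n) (Fin n) ℝ) : 0 ≤ fnorm X := Real.sqrt_nonneg _

lemma fr_transpose {a b : ℕ} (A : Matrix (Fin a) (Fin b) ℝ) : fr Aᵀ = fr A := by
  rw [fr_eq, fr_eq, Finset.sum_comm]; rfl

lemma fr_mul {a b c : ℕ} (A : Matrix (Fin a) (Fin b) ℝ) (B : Matrix (Fin b) (Fin c) ℝ) :
    fr (A * B) ≤ fr A * fr B := by
  rw [fr_eq, fr_eq, ← fr_transpose B, fr_eq, Finset.sum_mul_sum]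
  refine Finset.sum_le_sum fun i _ => Finset.sum_le_sum fun j _ => ?_
  rw [Matrix.mul_apply]
  exact Finset.sum_mul_sq_le_sq_mul_sq _ _ _

lemma fr_pyth {a b c : ℕ} (A : Matrix (Fin a) (Fin b) ℝ) (V : Matrix (Fin b) (Fin c) ℝ)
    (hV : Vᵀ * V = 1) : fr A = fr (A * V) + fr (A - A * (V * Vᵀ)) := by
  have e1 : (A - A * (V * Vᵀ))ᵀ * (A - A * (V * Vᵀ)) =
      Aᵀ * A - Aᵀ * A * V * Vᵀ - V * (Vᵀ * Aᵀ * A) + V * (Vᵀ * Aᵀ * A * V * Vᵀ) := by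
    simp only [Matrix.transpose_sub, Matrix.transpose_mul, Matrix.transpose_transpose,
      Matrix.sub_mul, Matrix.mul_sub, Matrix.mul_assoc]
    abel
  have e2 : (A * V)ᵀ * (A * V) = Vᵀ * Aᵀ * A * V := by
    simp only [Matrix.transpose_mul, Matrix.mul_assoc]
  unfold fr
  rw [e1, e2, Matrix.trace_add, Matrix.trace_sub, Matrix.trace_sub,
    Matrix.trace_mul_comm (Aᵀ * A * V) Vᵀ, Matrix.trace_mul_comm V, Matrix.trace_mul_comm V]
  simp only [Matrix.mul_assoc, hV, Matrix.mul_one]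
  ring

lemma fr_mul_le {a b c : ℕ} (A : Matrix (Fin a) (Fin b) ℝ) (V : Matrix (Fin b) (Fin c) ℝ)
    (hV : Vᵀ * V = 1) : fr (A * V) ≤ fr A := by
  rw [fr_pyth A V hV]; linarith [fr_nonneg (A - A * (V * Vᵀ))]

lemma fr_sub_le {a b c : ℕ} (A : Matrix (Fin a) (Fin b) ℝ) (V : Matrix (Fin b) (Fin c) ℝ)
    (hV : Vᵀ * V = 1) : fr (A - A * (V * Vᵀ)) ≤ fr A := by
  have := fr_pyth A V hV
  linarith [fr_nonneg (A * V)]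

lemma fr_mul_le' {a b c : ℕ} (A : Matrix (Fin b) (Fin a) ℝ) (V : Matrix (Fin b) (Fin c) ℝ)
    (hV : Vᵀ * V = 1) : fr (Vᵀ * A) ≤ fr A := by
  have := fr_mul_le Aᵀ V hV
  rwa [← fr_transpose, Matrix.transpose_mul, Matrix.transpose_transpose, ← fr_transpose A]

lemma fr_sub_le' {a b c : ℕ} (A : Matrix (Fin b) (Fin a) ℝ) (V : Matrix (Fin b) (Fin c) ℝ)
    (hV : Vᵀ * V = 1) : fr (A - V * Vᵀ * A) ≤ fr A := by
  have := fr_sub_le Aᵀ V hV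
  rwa [← fr_transpose, Matrix.transpose_sub, Matrix.transpose_mul, Matrix.transpose_mul,
    Matrix.transpose_transpose, ← fr_transpose A]

lemma fr_mul_diag {a b : ℕ} (A : Matrix (Fin a) (Fin b) ℝ) (d : Fin b → ℝ) (c : ℝ) (hc : 0 < c)
    (hd : ∀ i, c ≤ d i) : fr (A * Matrix.diagonal (fun i => (d i)⁻¹)) ≤ fr A / c ^ 2 := by
  rw [fr_eq, fr_eq, Finset.sum_div]
  refine Finset.sum_le_sum fun i _ => ?_
  rw [Finset.sum_div]
  refine Finset.sum_le_sum fun j _ => ?_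
  rw [Matrix.mul_diagonal, mul_pow, div_eq_mul_inv, inv_pow]
  have := hd j
  gcongr

lemma fr_svd {n r : ℕ} (U V : Matrix (Fin n) (Fin r) ℝ) (d : Fin r → ℝ)
    (hU : Uᵀ * U = 1) (hV : Vᵀ * V = 1) :
    fr (U * Matrix.diagonal d * Vᵀ) ≤ ∑ i, d i ^ 2 := by
  have h1 := fr_mul_le (U * Matrix.diagonal d * Vᵀ)ᵀ U hU
  have h : fr (U * Matrix.diagonal d * Vᵀ) = ∑ i, d i ^ 2 := by
    unfold fr
    have : (U * Matrix.diagonal d * Vᵀ)ᵀ * (U * Matrix.diagonal d * Vᵀ) =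
      V * (Matrix.diagonal d * (Uᵀ * U) * Matrix.diagonal d * Vᵀ) := by
      simp only [Matrix.transpose_mul, Matrix.transpose_transpose, Matrix.mul_assoc,
        Matrix.diagonal_transpose]
    rw [this, hU, Matrix.trace_mul_comm, Matrix.mul_assoc _ Vᵀ V, hV]
    simp [Matrix.trace, pow_two]
  exact h.le

lemma sub_Pt {n r : ℕ} (U V : Matrix (Fin n) (Fin r) ℝ) (X : Matrix (Fin n) (Fin n) ℝ) :
    X - Pt U V X = (1 - U * Uᵀ) * X * (1 - V * Vᵀ) := by
  unfold Pt
  simp only [Matrix.sub_mul, Matrix.mul_sub, Matrix.one_mul, Matrix.mul_one]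
  abel

lemma Pt_self {n r : ℕ} (U V : Matrix (Fin n) (Fin r) ℝ) (S : Matrix (Fin r) (Fin r) ℝ)
    (hU : Uᵀ * U = 1) : Pt U V (U * S * Vᵀ) = U * S * Vᵀ := by
  have : U * Uᵀ * (U * S * Vᵀ) = U * S * Vᵀ := by
    calc _ = U * (Uᵀ * U) * S * Vᵀ := by simp only [Matrix.mul_assoc]
      _ = _ := by rw [hU, Matrix.mul_one]
  unfold Pt
  rw [this]; abel

lemma Pt_sub {n r : ℕ} (U V : Matrix (Fin n) (Fin r) ℝ) (X Y : Matrix (Fin n) (Fin n) ℝ) :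
    Pt U V (X - Y) = Pt U V X - Pt U V Y := by
  unfold Pt
  simp only [Matrix.sub_mul, Matrix.mul_sub]
  abel

lemma Pt_add {n r : ℕ} (U V : Matrix (Fin n) (Fin r) ℝ) (X Y : Matrix (Fin n) (Fin n) ℝ) :
    Pt U V (X + Y) = Pt U V X + Pt U V Y := by
  unfold Pt
  simp only [Matrix.add_mul, Matrix.mul_add]
  abel

lemma Pt_smul {n r : ℕ} (U V : Matrix (Fin n) (Fin r) ℝ) (c : ℝ) (X : Matrix (Fin n) (Fin n) ℝ) :
    Pt U V (c • X) = c • Pt U V X := by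
  unfold Pt
  simp only [Matrix.smul_mul, Matrix.mul_smul, smul_add, smul_sub]

lemma Pt_idem {n r : ℕ} (U V : Matrix (Fin n) (Fin r) ℝ) (X : Matrix (Fin n) (Fin n) ℝ)
    (hU : Uᵀ * U = 1) (hV : Vᵀ * V = 1) : Pt U V (Pt U V X) = Pt U V X := by
  have hP : U * Uᵀ * (U * Uᵀ) = U * Uᵀ := by
    rw [Matrix.mul_assoc, ← Matrix.mul_assoc Uᵀ, hU, Matrix.one_mul]
  have hQ : V * Vᵀ * (V * Vᵀ) = V * Vᵀ := by
    rw [Matrix.mul_assoc, ← Matrix.mul_assoc Vᵀ, hV, Matrix.one_mul]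
  unfold Pt
  generalize U * Uᵀ = P at *
  generalize V * Vᵀ = Q at *
  have h1 : ∀ Y : Matrix (Fin n) (Fin n) ℝ, P * (P * Y) = P * Y := fun Y => by
    rw [← Matrix.mul_assoc, hP]
  simp only [Matrix.add_mul, Matrix.mul_add, Matrix.sub_mul, Matrix.mul_sub, Matrix.mul_assoc,
    h1, hQ]
  abel

lemma Pt_adj {n r : ℕ} (U V : Matrix (Fin n) (Fin r) ℝ) (X Y : Matrix (Fin n) (Fin n) ℝ) :
    finner (Pt U V X) Y = finner X (Pt U V Y) := by
  unfold finner Pt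
  simp only [Matrix.transpose_add, Matrix.transpose_sub, Matrix.transpose_mul,
    Matrix.transpose_transpose, Matrix.add_mul, Matrix.sub_mul, Matrix.mul_add, Matrix.mul_sub,
    Matrix.trace_add, Matrix.trace_sub]
  generalize U * Uᵀ = P at *
  generalize V * Vᵀ = Q at *
  have h1 : (Q * Xᵀ * Y).trace = (Xᵀ * (Y * Q)).trace := by
    rw [Matrix.mul_assoc, Matrix.trace_mul_comm, Matrix.mul_assoc]
  have h2 : (Q * (Xᵀ * P) * Y).trace = (Xᵀ * (P * Y * Q)).trace := by
    rw [Matrix.mul_assoc, Matrix.trace_mul_comm]; simp only [Matrix.mul_assoc]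
  rw [h1, h2, Matrix.mul_assoc Xᵀ P Y]

lemma rank_smul_le' {n : ℕ} (c : ℝ) (X : Matrix (Fin n) (Fin n) ℝ) : (c • X).rank ≤ X.rank := by
  have : c • X = (c • (1 : Matrix (Fin n) (Fin n) ℝ)) * X := by simp
  rw [this]; exact Matrix.rank_mul_le_right _ _

lemma rank_add_le' {n : ℕ} (X Y : Matrix (Fin n) (Fin n) ℝ) :
    (X + Y).rank ≤ X.rank + Y.rank := by
  unfold Matrix.rank
  rw [Matrix.mulVecLin_add]
  refine le_trans (Submodule.finrank_mono (LinearMap.range_add_le _ _)) ?_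
  exact Submodule.finrank_add_le_finrank_add_finrank _ _

lemma rank_UM {n r : ℕ} (U : Matrix (Fin n) (Fin r) ℝ) (M : Matrix (Fin r) (Fin n) ℝ) :
    (U * M).rank ≤ r :=
  (Matrix.rank_mul_le_left _ _).trans ((Matrix.rank_le_card_width U).trans (by simp))

lemma rank_Pt {n r : ℕ} (U V : Matrix (Fin n) (Fin r) ℝ) (X : Matrix (Fin n) (Fin n) ℝ) :
    (Pt U V X).rank ≤ 2 * r := by
  have : Pt U V X = U * (Uᵀ * X - Uᵀ * X * (V * Vᵀ)) + (X * V) * Vᵀ := by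
    unfold Pt
    simp only [Matrix.mul_sub, Matrix.mul_assoc]
    abel
  rw [this]
  refine (rank_add_le' _ _).trans ?_
  have := rank_UM U (Uᵀ * X - Uᵀ * X * (V * Vᵀ))
  have := rank_UM (X * V) Vᵀ
  omega

lemma normal_bound {n r : ℕ} (U V UX VX : Matrix (Fin n) (Fin r) ℝ) (S : Matrix (Fin r) (Fin r) ℝ)
    (d : Fin r → ℝ)
    (hU : Uᵀ * U = 1) (hV : Vᵀ * V = 1) (hUX : UXᵀ * UX = 1) (hVX : VXᵀ * VX = 1)
    (c : ℝ) (hc : 0 < c) (hd : ∀ i, c ≤ d i) (X Y : Matrix (Fin n) (Fin n) ℝ)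
    (hX : X = UX * Matrix.diagonal d * VXᵀ) (hY : Y = U * S * Vᵀ) :
    fr (X - Pt U V X) ≤ (fr (Y - X) / c) ^ 2 := by
  have hYX : fr (Y - X) = fr (X - Y) := by
    rw [fr_eq, fr_eq]
    simp only [Matrix.sub_apply, fun x y : ℝ => (sub_sq_comm x y)]
  have hB : (X - Y) - U * Uᵀ * (X - Y) = X - U * Uᵀ * X := by
    have : U * Uᵀ * Y = Y := by
      rw [hY]
      calc _ = U * (Uᵀ * U) * S * Vᵀ := by simp only [Matrix.mul_assoc]
        _ = _ := by rw [hU, Matrix.mul_one]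
    rw [Matrix.mul_sub, this]; abel
  have hC : (X - Y) - (X - Y) * (V * Vᵀ) = X - X * (V * Vᵀ) := by
    have : Y * (V * Vᵀ) = Y := by
      rw [hY]
      calc _ = U * S * ((Vᵀ * V) * Vᵀ) := by simp only [Matrix.mul_assoc]
        _ = _ := by rw [hV, Matrix.one_mul]
    rw [Matrix.sub_mul, this]; abel
  have hS : Matrix.diagonal d * Matrix.diagonal (fun i => (d i)⁻¹) = 1 := by
    rw [Matrix.diagonal_mul_diagonal, ← Matrix.diagonal_one]
    congr 1; funext i
    exact mul_inv_cancel₀ (hc.trans_le (hd i)).ne'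
  have hXV : X * VX * Matrix.diagonal (fun i => (d i)⁻¹) = UX := by
    rw [hX]
    calc _ = UX * (Matrix.diagonal d * (VXᵀ * VX) * Matrix.diagonal (fun i => (d i)⁻¹)) := by
            simp only [Matrix.mul_assoc]
      _ = UX := by rw [hVX, Matrix.mul_one, hS, Matrix.mul_one]
  have hUU : UX * (UXᵀ * X) = X := by
    rw [hX]
    calc _ = UX * (UXᵀ * UX) * Matrix.diagonal d * VXᵀ := by simp only [Matrix.mul_assoc]
      _ = _ := by rw [hUX, Matrix.mul_one]
  have key : X - Pt U V X = ((X - U * Uᵀ * X) * VX * Matrix.diagonal (fun i => (d i)⁻¹)) *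
      (UXᵀ * (X - X * (V * Vᵀ))) := by
    have e1 : (X - U * Uᵀ * X) * VX * Matrix.diagonal (fun i => (d i)⁻¹) = (1 - U * Uᵀ) * UX := by
      conv_rhs => rw [← hXV]
      simp only [Matrix.sub_mul, Matrix.one_mul, Matrix.mul_assoc]
    have e2 : UXᵀ * (X - X * (V * Vᵀ)) = UXᵀ * X * (1 - V * Vᵀ) := by
      simp only [Matrix.mul_sub, Matrix.mul_one, Matrix.mul_assoc]
    rw [e1, e2, sub_Pt, Matrix.mul_assoc (1 - U * Uᵀ) UX, ← Matrix.mul_assoc UX, hUU,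
      Matrix.mul_assoc]
  rw [key, hYX]
  refine (fr_mul _ _).trans ?_
  have b1 := fr_mul_diag ((X - U * Uᵀ * X) * VX) d c hc hd
  have b2 := fr_mul_le (X - U * Uᵀ * X) VX hVX
  have b3 := fr_sub_le' (X - Y) U hU
  have b4 := fr_mul_le' (X - X * (V * Vᵀ)) UX hUX
  have b5 := fr_sub_le (X - Y) V hV
  rw [hB] at b3
  rw [hC] at b5
  have b6 : fr ((X - U * Uᵀ * X) * VX * Matrix.diagonal (fun i => (d i)⁻¹)) ≤ fr (X - Y) / c ^ 2 :=
    b1.trans (by gcongr; exact b2.trans b3)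
  calc _ ≤ fr (X - Y) / c ^ 2 * fr (X - Y) :=
        mul_le_mul b6 (b4.trans b5) (fr_nonneg _) (div_nonneg (fr_nonneg _) (by positivity))
    _ = _ := by ring

/-! Ensembles. -/

def tv {n s : ℕ} : (Fin s → Matrix (Fin n) (Fin n) ℝ) →ₗ[ℝ]
    EuclideanSpace ℝ (Fin s × Fin n × Fin n) where
  toFun Z := WithLp.toLp 2 (fun p => Z p.1 p.2.1 p.2.2)
  map_add' _ _ := rfl
  map_smul' _ _ := rfl

lemma tv_inner {n s : ℕ} (Z W : Fin s → Matrix (Fin n) (Fin n) ℝ) :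
    inner ℝ (tv Z) (tv W) = ∑ k, finner (Z k) (W k) := by
  simp only [finner_eq, PiLp.inner_apply, tv, Fintype.sum_prod_type]
  simp [mul_comm]
  rfl

lemma tv_norm_sq {n s : ℕ} (Z : Fin s → Matrix (Fin n) (Fin n) ℝ) :
    ‖tv Z‖ ^ 2 = ∑ k, fnorm (Z k) ^ 2 := by
  rw [← real_inner_self_eq_norm_sq, tv_inner]
  simp only [fnorm_sq]; rfl

lemma tv_norm {n s : ℕ} (Z : Fin s → Matrix (Fin n) (Fin n) ℝ) :
    ‖tv Z‖ = Real.sqrt (∑ k, fnorm (Z k) ^ 2) := by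
  rw [← tv_norm_sq, Real.sqrt_sq (norm_nonneg _)]

lemma tv_norm_le {n s : ℕ} (Z W : Fin s → Matrix (Fin n) (Fin n) ℝ) (c : ℝ) (hc : 0 ≤ c)
    (h : ∀ k, fnorm (Z k) ≤ c * fnorm (W k)) : ‖tv Z‖ ≤ c * ‖tv W‖ := by
  refine abs_le_of_sq_le_sq' ?_ (by positivity) |>.2
  rw [mul_pow, tv_norm_sq, tv_norm_sq, Finset.mul_sum]
  refine Finset.sum_le_sum fun k _ => ?_
  rw [← mul_pow]
  exact pow_le_pow_left₀ (fnorm_nonneg _) (h k) 2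

lemma fnorm_smul {n : ℕ} (c : ℝ) (X : Matrix (Fin n) (Fin n) ℝ) :
    fnorm (c • X) = |c| * fnorm X := by
  unfold fnorm finner
  rw [Matrix.transpose_smul, Matrix.smul_mul, Matrix.mul_smul, Matrix.trace_smul,
    Matrix.trace_smul, smul_eq_mul, smul_eq_mul, ← mul_assoc, Real.sqrt_mul (mul_self_nonneg c),
    Real.sqrt_mul_self_eq_abs]

lemma fnorm_tv {n : ℕ} (X : Matrix (Fin n) (Fin n) ℝ) :
    fnorm X = ‖tv (fun _ : Fin 1 => X)‖ := by
  rw [tv_norm]; simp [Real.sqrt_sq (fnorm_nonneg X)]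

lemma fnorm_sub_comm {n : ℕ} (X Y : Matrix (Fin n) (Fin n) ℝ) : fnorm (X - Y) = fnorm (Y - X) := by
  have := fnorm_smul (-1) (Y - X)
  simpa using this

lemma fnorm_tri {n : ℕ} (X Y Z : Matrix (Fin n) (Fin n) ℝ) :
    fnorm (X - Z) ≤ fnorm (X - Y) + fnorm (Y - Z) := by
  rw [fnorm_tv, fnorm_tv, fnorm_tv]
  have : (fun _ : Fin 1 => X - Z) = (fun _ => X - Y) + (fun _ => Y - Z) := by
    funext; simp
  rw [this, map_add]
  exact norm_add_le _ _

def Lop {n m s : ℕ} (A : Fin s → Fin m → Matrix (Fin n) (Fin n) ℝ) :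
    (Fin s → Matrix (Fin n) (Fin n) ℝ) →ₗ[ℝ] EuclideanSpace ℝ (Fin m) where
  toFun Z := WithLp.toLp 2 (∑ k, opA (A k) (Z k))
  map_add' Z W := by
    ext p
    simp [opA, finner, mul_add, Finset.sum_add_distrib]
  map_smul' c Z := by
    ext p
    simp only [opA, finner, Pi.smul_apply, Matrix.mul_smul, Matrix.trace_smul, smul_eq_mul,
      Finset.sum_apply, PiLp.smul_apply, RingHom.id_apply, Finset.mul_sum]
    refine Finset.sum_congr rfl fun k _ => ?_
    ring

lemma enorm2_eq {m : ℕ} (v : Fin m → ℝ) : enorm2 v = ‖(WithLp.toLp 2 v : EuclideanSpace ℝ (Fin m))‖ := by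
  rw [EuclideanSpace.norm_eq]; simp [enorm2]

lemma finner_adj {n m : ℕ} (A : Fin m → Matrix (Fin n) (Fin n) ℝ) (Z : Matrix (Fin n) (Fin n) ℝ)
    (v : Fin m → ℝ) : finner Z (adjA A v) = ∑ p, opA A Z p * v p := by
  have hc : ∀ p, finner (A p) Z = finner Z (A p) := fun p => by
    simp only [finner_eq, mul_comm]
  unfold adjA opA
  simp only [hc]
  unfold finner
  rw [Matrix.mul_smul, Matrix.trace_smul, Matrix.mul_sum, Matrix.trace_sum, smul_eq_mul,
    Finset.mul_sum]
  refine Finset.sum_congr rfl fun p _ => ?_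
  rw [Matrix.mul_smul, Matrix.trace_smul, smul_eq_mul]
  ring

lemma tv_adj {n m s : ℕ} (A : Fin s → Fin m → Matrix (Fin n) (Fin n) ℝ)
    (Z : Fin s → Matrix (Fin n) (Fin n) ℝ) (v : EuclideanSpace ℝ (Fin m)) :
    inner ℝ (tv Z) (tv (fun k => adjA (A k) v.ofLp)) = inner ℝ (Lop A Z) v := by
  rw [tv_inner]
  simp only [finner_adj, PiLp.inner_apply, Lop]
  rw [Finset.sum_comm]
  simp [Finset.mul_sum, mul_comm]

lemma polar {M H K : Type*} [AddCommGroup M] [Module ℝ M] [NormedAddCommGroup H]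
    [InnerProductSpace ℝ H] [NormedAddCommGroup K] [InnerProductSpace ℝ K]
    (f : M →ₗ[ℝ] H) (L : M →ₗ[ℝ] K) (x z : M) (δ : ℝ)
    (h : ∀ a b : ℝ, |‖L (a • x + b • z)‖ ^ 2 - ‖f (a • x + b • z)‖ ^ 2| ≤
      δ * ‖f (a • x + b • z)‖ ^ 2) :
    |inner ℝ (L x) (L z) - inner ℝ (f x) (f z)| ≤ δ * (‖f x‖ * ‖f z‖) := by
  have ex : ∀ (a b : ℝ), 4 * (a * b) * (inner ℝ (L x) (L z) - inner ℝ (f x) (f z)) =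
      (‖L (a • x + b • z)‖ ^ 2 - ‖f (a • x + b • z)‖ ^ 2) -
      (‖L (a • x + (-b) • z)‖ ^ 2 - ‖f (a • x + (-b) • z)‖ ^ 2) := by
    intro a b
    simp only [map_add, map_smul, norm_add_sq_real, norm_smul, inner_smul_left, inner_smul_right]
    simp
    ring
  have ex2 : ∀ (a b : ℝ), ‖f (a • x + b • z)‖ ^ 2 + ‖f (a • x + (-b) • z)‖ ^ 2 =
      2 * (a ^ 2 * ‖f x‖ ^ 2 + b ^ 2 * ‖f z‖ ^ 2) := by
    intro a b
    simp only [map_add, map_smul, norm_add_sq_real, norm_smul, inner_smul_left, inner_smul_right]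
    simp only [mul_pow, Real.norm_eq_abs, sq_abs]
    simp
    ring
  have bd : ∀ a b : ℝ, |4 * (a * b) * (inner ℝ (L x) (L z) - inner ℝ (f x) (f z))| ≤
      δ * (2 * (a ^ 2 * ‖f x‖ ^ 2 + b ^ 2 * ‖f z‖ ^ 2)) := by
    intro a b
    rw [ex, ← ex2, mul_add]
    exact (abs_sub _ _).trans (add_le_add (h a b) (h a (-b)))
  have Lz : ∀ a b : ℝ, f (a • x + b • z) = 0 → L (a • x + b • z) = 0 := by
    intro a b h0
    have := h a b
    rw [h0] at this
    simpa using this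
  by_cases hx : f x = 0
  · have : L x = 0 := by simpa using Lz 1 0 (by simpa using hx)
    simp [hx, this]
  by_cases hz : f z = 0
  · have : L z = 0 := by simpa using Lz 0 1 (by simpa using hz)
    simp [hz, this]
  have px := norm_pos_iff.2 hx
  have pz := norm_pos_iff.2 hz
  have := bd ‖f z‖ ‖f x‖
  rw [abs_mul, abs_of_pos (by positivity)] at this
  have p : 0 < 4 * (‖f z‖ * ‖f x‖) := by positivity
  refine le_of_mul_le_mul_left (this.trans (le_of_eq ?_)) p
  ring

lemma arip_polar {n m s q : ℕ} (A : Fin s → Fin m → Matrix (Fin n) (Fin n) ℝ) (δ : ℝ)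
    (hA : ARIP (fun k => opA (A k)) q δ) (x z : Fin s → Matrix (Fin n) (Fin n) ℝ)
    (h : ∀ (a b : ℝ) k, (a • x k + b • z k).rank ≤ q) :
    |inner ℝ (Lop A x) (Lop A z) - inner ℝ (tv x) (tv z)| ≤ δ * (‖tv x‖ * ‖tv z‖) := by
  refine polar tv (Lop A) x z δ fun a b => ?_
  have := hA (a • x + b • z) (fun k => h a b k)
  rw [enorm2_eq, ← tv_norm_sq] at this
  change _ ≤ ‖Lop A _‖ ^ 2 ∧ ‖Lop A _‖ ^ 2 ≤ _ at this
  rw [abs_le]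
  constructor <;> linarith [this.1, this.2]

lemma fnorm_pos {n : ℕ} (X : Matrix (Fin n) (Fin n) ℝ) (h : X ≠ 0) : 0 < fnorm X := by
  rw [fnorm_tv, norm_pos_iff]
  intro h0
  apply h
  ext i j
  have := congrArg (fun v : EuclideanSpace ℝ (Fin 1 × Fin n × Fin n) => v (0, i, j)) h0
  exact this

lemma single_arip {n m s q : ℕ} (A : Fin s → Fin m → Matrix (Fin n) (Fin n) ℝ) (δ : ℝ)
    (hA : ARIP (fun k => opA (A k)) q δ) (k : Fin s) (Z : Matrix (Fin n) (Fin n) ℝ)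
    (hZ : Z.rank ≤ q) : (1 - δ) * fnorm Z ^ 2 ≤ enorm2 (opA (A k) Z) ^ 2 ∧
      enorm2 (opA (A k) Z) ^ 2 ≤ (1 + δ) * fnorm Z ^ 2 := by
  have h := hA (Pi.single k Z) (by
    intro j
    by_cases hj : j = k
    · subst hj; simpa using hZ
    · simp [Pi.single_eq_of_ne hj])
  have e1 : ∑ j, fnorm ((Pi.single k Z : Fin s → Matrix (Fin n) (Fin n) ℝ) j) ^ 2
      = fnorm Z ^ 2 := by
    rw [Finset.sum_eq_single k]
    · simp
    · intro j _ hj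
      simp [Pi.single_eq_of_ne hj, fnorm, finner]
    · simp
  have e2 : ∑ j, opA (A j) ((Pi.single k Z : Fin s → Matrix (Fin n) (Fin n) ℝ) j)
      = opA (A k) Z := by
    rw [Finset.sum_eq_single k]
    · simp
    · intro j _ hj
      funext p
      simp [Pi.single_eq_of_ne hj, opA, finner]
    · simp
  simp only [e1, e2] at h
  exact h

lemma step_bound (p q δ : ℝ) (hp : 0 < p) (hδ : δ < 1) (h1 : (1 - δ) * p ≤ q)
    (h2 : q ≤ (1 + δ) * p) : |p / q| ≤ 1 / (1 - δ) ∧ |1 - p / q| ≤ δ / (1 - δ) := by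
  have h1δ : 0 < 1 - δ := by linarith
  have hq : 0 < q := lt_of_lt_of_le (by positivity) h1
  have hd : 0 ≤ δ := by
    by_contra hneg
    push Not at hneg
    nlinarith
  have ha : p / q ≤ 1 / (1 - δ) := by
    rw [div_le_div_iff₀ hq h1δ]; linarith
  refine ⟨by rwa [abs_of_pos (by positivity)], ?_⟩
  have : 1 - p / q = (q - p) / q := by field_simp
  rw [this, abs_div, abs_of_pos hq]
  have hb : |q - p| ≤ δ * p := by rw [abs_le]; constructor <;> linarith
  calc |q - p| / q ≤ δ * p / q := by gcongr
    _ = δ * (p / q) := by ring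
    _ ≤ δ * (1 / (1 - δ)) := by gcongr
    _ = _ := by ring

/-- **Theorem 4 (linear convergence of FIHT).** -/
theorem fiht_convergence
    {n m r s : ℕ}
    (A : Fin s → Fin m → Matrix (Fin n) (Fin n) ℝ)
    (δ₂ δ₃ : ℝ) (hδ₂₃ : δ₂ ≤ δ₃) (hδ₃ : δ₃ < 1)
    (hARIP2 : ARIP (fun k => opA (A k)) (2 * r) δ₂)
    (hARIP3 : ARIP (fun k => opA (A k)) (3 * r) δ₃)
    -- the target matrices, of rank exactly `r`, via their compact SVDs
    (X : Fin s → Matrix (Fin n) (Fin n) ℝ)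
    (UX VX : Fin s → Matrix (Fin n) (Fin r) ℝ)
    (SX : Fin s → Matrix (Fin r) (Fin r) ℝ)
    (hUX : ∀ k, (UX k)ᵀ * UX k = 1) (hVX : ∀ k, (VX k)ᵀ * VX k = 1)
    (hSXdiag : ∀ k i j, i ≠ j → SX k i j = 0) (hSXpos : ∀ k i, 0 < SX k i i)
    (hXsvd : ∀ k, X k = UX k * SX k * (VX k)ᵀ)
    -- the extreme singular values over all constituents
    (σmax σmin : ℝ)
    (hσmax : IsGreatest {x : ℝ | ∃ k i, SX k i i = x} σmax)
    (hσmin : IsLeast {x : ℝ | ∃ k i, SX k i i = x} σmin)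
    -- the contraction factor
    (hγ : 2 * (2 * δ₂ / (1 - δ₂) + δ₃ / (1 - δ₂) +
        2 * δ₃ * Real.sqrt (r * s) * (σmax / σmin)) < 1)
    -- the measurements and the FIHT iterates, of rank exactly `r`, via their SVDs
    (y : Fin m → ℝ) (hy : y = ∑ k, opA (A k) (X k))
    (Xl : ℕ → Fin s → Matrix (Fin n) (Fin n) ℝ)
    (hInit : ∀ k, IsBestRankApprox r (adjA (A k) y) (Xl 0 k))
    (U V : ℕ → Fin s → Matrix (Fin n) (Fin r) ℝ)
    (S : ℕ → Fin s → Matrix (Fin r) (Fin r) ℝ)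
    (hU : ∀ l k, (U l k)ᵀ * U l k = 1) (hV : ∀ l k, (V l k)ᵀ * V l k = 1)
    (hSdiag : ∀ l k i j, i ≠ j → S l k i j = 0) (hSpos : ∀ l k i, 0 < S l k i i)
    (hXl : ∀ l k, Xl l k = U l k * S l k * (V l k)ᵀ)
    (G : ℕ → Fin s → Matrix (Fin n) (Fin n) ℝ)
    (hG : ∀ l k, G l k = adjA (A k) (y - ∑ j, opA (A j) (Xl l j)))
    (hPt : ∀ l k, Pt (U l k) (V l k) (G l k) ≠ 0)
    (α : ℕ → Fin s → ℝ)
    (hα : ∀ l k, α l k = fnorm (Pt (U l k) (V l k) (G l k)) ^ 2 /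
        enorm2 (opA (A k) (Pt (U l k) (V l k) (G l k))) ^ 2)
    (hNext : ∀ l k, IsBestRankApprox r
        (Xl l k + α l k • Pt (U l k) (V l k) (G l k)) (Xl (l + 1) k)) :
    ∀ l : ℕ,
      Real.sqrt (∑ k, fnorm (Xl (l + 1) k - X k) ^ 2) ≤
        2 * (2 * δ₂ / (1 - δ₂) + δ₃ / (1 - δ₂) +
            2 * δ₃ * Real.sqrt (r * s) * (σmax / σmin)) *
          Real.sqrt (∑ k, fnorm (Xl l k - X k) ^ 2) := by
  classical
  obtain ⟨⟨k0, i0, hki0⟩, hmaxU⟩ := hσmax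
  obtain ⟨⟨k1, i1, hki1⟩, hminL⟩ := hσmin
  have hσpos : 0 < σmin := by rw [← hki1]; exact hSXpos _ _
  have hσpos' : 0 < σmax := by rw [← hki0]; exact hSXpos _ _
  have hXd : ∀ k, X k = UX k * Matrix.diagonal (fun i => SX k i i) * (VX k)ᵀ := by
    intro k
    rw [hXsvd k]
    congr 2
    ext i j
    by_cases hij : i = j
    · subst hij; simp
    · rw [hSXdiag k i j hij, Matrix.diagonal_apply_ne _ hij]
  have hδ₂1 : δ₂ < 1 := lt_of_le_of_lt hδ₂₃ hδ₃
  have h1δ : 0 < 1 - δ₂ := by linarith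
  have hrX : ∀ k, (X k).rank ≤ r := fun k => by
    rw [hXsvd k, Matrix.mul_assoc]; exact rank_UM _ _
  have hrXl : ∀ l k, (Xl l k).rank ≤ r := fun l k => by
    rw [hXl l k, Matrix.mul_assoc]; exact rank_UM _ _
  have hsingle := fun k Z hZ => single_arip A δ₂ hARIP2 k Z hZ
  -- nonnegativity of δ
  have hδ₂0 : 0 ≤ δ₂ := by
    obtain ⟨h1, h2⟩ := hsingle k0 _ (rank_Pt (U 0 k0) (V 0 k0) (G 0 k0))
    have h3 := fnorm_pos _ (hPt 0 k0)
    have h4 : 0 < fnorm (Pt (U 0 k0) (V 0 k0) (G 0 k0)) ^ 2 := by positivity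
    by_contra hneg
    push Not at hneg
    nlinarith
  have hδ₃0 : 0 ≤ δ₃ := hδ₂0.trans hδ₂₃
  -- step sizes
  have hαb : ∀ l k, |α l k| ≤ 1 / (1 - δ₂) ∧ |1 - α l k| ≤ δ₂ / (1 - δ₂) := by
    intro l k
    obtain ⟨h1, h2⟩ := hsingle k _ (rank_Pt (U l k) (V l k) (G l k))
    have h3 := fnorm_pos _ (hPt l k)
    have h4 : 0 < fnorm (Pt (U l k) (V l k) (G l k)) ^ 2 := by positivity
    rw [hα l k]
    exact step_bound _ _ δ₂ h4 hδ₂1 h1 h2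
  -- norm of X
  have hXn : ‖tv X‖ ≤ Real.sqrt (r * s) * σmax := by
    refine abs_le_of_sq_le_sq' ?_ (by positivity) |>.2
    rw [mul_pow, Real.sq_sqrt (by positivity), tv_norm_sq]
    calc ∑ k, fnorm (X k) ^ 2 ≤ ∑ k : Fin s, ∑ i : Fin r, σmax ^ 2 := by
          refine Finset.sum_le_sum fun k _ => ?_
          rw [fnorm_sq, hXd k]
          refine (fr_svd _ _ _ (hUX k) (hVX k)).trans ?_
          refine Finset.sum_le_sum fun i _ => ?_
          exact pow_le_pow_left₀ (hSXpos k i).le (hmaxU ⟨k, i, rfl⟩) 2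
      _ = _ := by simp; ring
  -- initialization
  have hy' : WithLp.toLp 2 y = Lop A X := by rw [hy]; rfl
  have hy2 : y = (Lop A X).ofLp := by rw [hy]; rfl
  have hinit : ‖tv (Xl 0 - X)‖ ≤ 2 * δ₃ * Real.sqrt (r * s) * σmax := by
    have hp := arip_polar A δ₂ hARIP2 (Xl 0 - X) X (by
      intro a b k
      have : a • (Xl 0 - X) k + b • X k = a • Xl 0 k + (b - a) • X k := by
        simp only [Pi.sub_apply]; module
      rw [this]
      refine (rank_add_le' _ _).trans ?_
      have := (rank_smul_le' a (Xl 0 k)).trans (hrXl 0 k)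
      have := (rank_smul_le' (b - a) (X k)).trans (hrX k)
      omega)
    have hle : ‖tv (Xl 0 - fun k => adjA (A k) y)‖ ≤ 1 * ‖tv (X - fun k => adjA (A k) y)‖ := by
      refine tv_norm_le _ _ 1 zero_le_one fun k => ?_
      rw [one_mul]
      exact (hInit k).2 (X k) (hrX k)
    have hadj := tv_adj A (Xl 0 - X) (Lop A X)
    rw [← hy2] at hadj
    rw [one_mul] at hle
    have e : tv (Xl 0 - fun k => adjA (A k) y) = tv (Xl 0 - X) + tv (X - fun k => adjA (A k) y) := by
      rw [← map_add]; congr 1; abel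
    have hle2 : ‖tv (Xl 0 - fun k => adjA (A k) y)‖ ^ 2 ≤ ‖tv (X - fun k => adjA (A k) y)‖ ^ 2 :=
      pow_le_pow_left₀ (norm_nonneg _) hle 2
    rw [e, norm_add_sq_real, map_sub tv X, inner_sub_right, hadj] at hle2
    have h5 := (abs_le.1 hp).2
    have h6 : ‖tv (Xl 0 - X)‖ ≤ 2 * δ₂ * ‖tv X‖ := by
      rcases eq_or_lt_of_le (norm_nonneg (tv (Xl 0 - X))) with h0 | h0
      · rw [← h0]; positivity
      · refine le_of_mul_le_mul_left ?_ h0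
        nlinarith
    calc _ ≤ 2 * δ₂ * ‖tv X‖ := h6
      _ ≤ 2 * δ₃ * (Real.sqrt (r * s) * σmax) := by gcongr
      _ = _ := by ring
  -- the one-step estimate
  have hstep : ∀ l, ‖tv (Xl (l + 1) - X)‖ ≤
      2 * (2 * δ₂ / (1 - δ₂) + δ₃ / (1 - δ₂) + ‖tv (Xl l - X)‖ / σmin) * ‖tv (Xl l - X)‖ := by
    intro l
    set D := Xl l - X with hD
    set P : (Fin s → Matrix (Fin n) (Fin n) ℝ) → (Fin s → Matrix (Fin n) (Fin n) ℝ) :=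
      fun Z k => Pt (U l k) (V l k) (Z k) with hP
    set ad : EuclideanSpace ℝ (Fin m) → (Fin s → Matrix (Fin n) (Fin n) ℝ) :=
      fun v k => adjA (A k) v.ofLp with had
    have Padj : ∀ Z W, inner ℝ (tv (P Z)) (tv W) = inner ℝ (tv Z) (tv (P W)) := fun Z W => by
      rw [tv_inner, tv_inner]; exact Finset.sum_congr rfl fun k _ => Pt_adj _ _ _ _
    have Pidem : ∀ Z, P (P Z) = P Z := fun Z => by
      funext k; exact Pt_idem _ _ _ (hU l k) (hV l k)
    have Psub : ∀ Z W, P (Z - W) = P Z - P W := fun Z W => by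
      funext k; exact Pt_sub _ _ _ _
    have Padd : ∀ Z W, P (Z + W) = P Z + P W := fun Z W => by
      funext k; exact Pt_add _ _ _ _
    have adadd : ∀ v w, ad (v + w) = ad v + ad w := fun v w => by
      funext k; simp [had, adjA, add_smul, Finset.sum_add_distrib]
    have adneg : ∀ v, ad (-v) = - ad v := fun v => by
      funext k; simp [had, adjA]
    have hadj : ∀ Z v, inner ℝ (tv Z) (tv (ad v)) = inner ℝ (Lop A Z) v := fun Z v => tv_adj A Z v
    set N := D - P D with hN
    set R1 := P D - P (ad (Lop A (P D))) with hR1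
    set R2 := P (ad (Lop A N)) with hR2
    have PR1 : P R1 = R1 := by rw [hR1, Psub, Pidem, Pidem]
    have PR2 : P R2 = R2 := by rw [hR2, Pidem]
    have PN : P N = 0 := by rw [hN, Psub, Pidem, sub_self]
    have hPDn : ‖tv (P D)‖ ≤ ‖tv D‖ := by
      have h1 : ‖tv (P D)‖ ^ 2 = inner ℝ (tv (P D)) (tv D) := by
        rw [← real_inner_self_eq_norm_sq, Padj D (P D), Pidem, Padj D D]
      have h2 := real_inner_le_norm (tv (P D)) (tv D)
      by_contra hc
      push Not at hc
      nlinarith [norm_nonneg (tv D), norm_nonneg (tv (P D))]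
    have hNn : ‖tv N‖ ≤ ‖tv D‖ := by
      have h1 : ‖tv N‖ ^ 2 = inner ℝ (tv N) (tv D) := by
        rw [← real_inner_self_eq_norm_sq]
        have e : inner ℝ (tv N) (tv N) = inner ℝ (tv N) (tv D) - inner ℝ (tv N) (tv (P D)) := by
          rw [← inner_sub_right, ← map_sub]
        rw [e, ← Padj N D, PN]
        simp
      have h2 := real_inner_le_norm (tv N) (tv D)
      by_contra hc
      push Not at hc
      nlinarith [norm_nonneg (tv D), norm_nonneg (tv N)]
    have hNk : ∀ k, N k = -(X k - Pt (U l k) (V l k) (X k)) := by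
      intro k
      have : Pt (U l k) (V l k) (Xl l k) = Xl l k := by
        rw [hXl l k]; exact Pt_self _ _ _ (hU l k)
      simp only [hN, hD, hP, Pi.sub_apply, Pt_sub, this]
      abel
    have hR1n : ‖tv R1‖ ≤ δ₂ * ‖tv D‖ := by
      have hp := arip_polar A δ₂ hARIP2 R1 (P D) (by
        intro a b k
        rw [← PR1]
        simp only [hP, ← Pt_smul, ← Pt_add]
        exact rank_Pt _ _ _)
      have h1 : ‖tv R1‖ ^ 2 =
          inner ℝ (tv R1) (tv (P D)) - inner ℝ (Lop A R1) (Lop A (P D)) := by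
        rw [← real_inner_self_eq_norm_sq, ← hadj]
        have e : inner ℝ (tv R1) (tv R1) = inner ℝ (tv R1) (tv (P D)) -
            inner ℝ (tv R1) (tv (P (ad (Lop A (P D))))) := by
          rw [← inner_sub_right, ← map_sub]
        rw [e, ← Padj R1 (ad _), PR1]
      have h2 := (abs_le.1 hp).1
      have h3 : ‖tv R1‖ ≤ δ₂ * ‖tv (P D)‖ := by
        rcases eq_or_lt_of_le (norm_nonneg (tv R1)) with h0 | h0
        · rw [← h0]; positivity
        · refine le_of_mul_le_mul_left ?_ h0
          nlinarith
      exact h3.trans (by gcongr)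
    have hR2n : ‖tv R2‖ ≤ δ₃ * ‖tv D‖ := by
      have hp := arip_polar A δ₃ hARIP3 R2 N (by
        intro a b k
        refine (rank_add_le' _ _).trans ?_
        have h1 : (a • R2 k).rank ≤ 2 * r := (rank_smul_le' _ _).trans (rank_Pt _ _ _)
        have h2 : (b • N k).rank ≤ r := by
          rw [hNk k, smul_neg, ← neg_smul, sub_Pt]
          exact (rank_smul_le' _ _).trans ((Matrix.rank_mul_le_left _ _).trans
            ((Matrix.rank_mul_le_right _ _).trans (hrX k)))
        omega)
      have h1 : ‖tv R2‖ ^ 2 = inner ℝ (Lop A R2) (Lop A N) := by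
        rw [← real_inner_self_eq_norm_sq, ← hadj]
        conv_lhs => arg 3; rw [hR2]
        rw [← Padj R2 (ad _), PR2]
      have h0 : inner ℝ (tv R2) (tv N) = 0 := by
        rw [← PR2, Padj, PN]; simp
      have h2 := (abs_le.1 hp).2
      have h3 : ‖tv R2‖ ≤ δ₃ * ‖tv N‖ := by
        rcases eq_or_lt_of_le (norm_nonneg (tv R2)) with h0 | h0
        · rw [← h0]; positivity
        · refine le_of_mul_le_mul_left ?_ h0
          nlinarith
      exact h3.trans (by gcongr)
    have hNn2 : ‖tv N‖ ≤ ‖tv D‖ / σmin * ‖tv D‖ := by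
      refine tv_norm_le _ _ _ (by positivity) fun k => ?_
      have hb := normal_bound (U l k) (V l k) (UX k) (VX k) (S l k) (fun i => SX k i i) (hU l k)
        (hV l k) (hUX k) (hVX k) σmin hσpos (fun i => hminL ⟨k, i, rfl⟩) (X k) (Xl l k) (hXd k)
        (hXl l k)
      have h1 : fnorm (N k) = fnorm (X k - Pt (U l k) (V l k) (X k)) := by
        rw [hNk k, neg_sub, fnorm_sub_comm]
      have h2 : fnorm (N k) ≤ fnorm (D k) ^ 2 / σmin := by
        rw [h1]
        refine abs_le_of_sq_le_sq' ?_ (by positivity) |>.2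
        rw [fnorm_sq, fnorm_sq]
        exact hb
      have h3 : fnorm (D k) ≤ ‖tv D‖ := by
        refine abs_le_of_sq_le_sq' ?_ (by positivity) |>.2
        rw [tv_norm_sq]
        exact Finset.single_le_sum (f := fun k => fnorm (D k) ^ 2) (fun i _ => sq_nonneg _)
          (Finset.mem_univ k)
      calc _ ≤ fnorm (D k) ^ 2 / σmin := h2
        _ = fnorm (D k) / σmin * fnorm (D k) := by ring
        _ ≤ _ := by
          have := fnorm_nonneg (D k)
          gcongr
    -- the update
    have hGl : G l = - ad (Lop A D) := by
      rw [← adneg, hD, map_sub, neg_sub]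
      funext k
      rw [hG l k, hy2]
      rfl
    have hPG : ∀ k, Pt (U l k) (V l k) (G l k) = - (P D k - R1 k + R2 k) := by
      intro k
      have : P (ad (Lop A D)) = P D - R1 + R2 := by
        have e : D = P D + N := by rw [hN]; abel
        conv_lhs => rw [e]
        rw [map_add, adadd, Padd, hR1, hR2]
        abel
      have h2 : P (G l) = - P (ad (Lop A D)) := by
        have h3 := Psub 0 (ad (Lop A D))
        have h4 : P 0 = 0 := by
          have := Psub 0 0
          rwa [sub_self, sub_self] at this
        rw [h4, zero_sub, zero_sub] at h3
        rw [hGl, h3]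
      have h3 := congrFun h2 k
      rw [this] at h3
      exact h3
    set W : Fin s → Matrix (Fin n) (Fin n) ℝ :=
      fun k => Xl l k + α l k • Pt (U l k) (V l k) (G l k) with hW
    have hWX : W - X = (fun k => (1 - α l k) • P D k) + (fun k => α l k • R1 k) + N
        - (fun k => α l k • R2 k) := by
      funext k
      have : Xl l k = D k + X k := by simp [hD]
      simp only [hW, Pi.sub_apply, Pi.add_apply, hPG k, this, hN]
      module
    have hWn : ‖tv (W - X)‖ ≤
        (2 * δ₂ / (1 - δ₂) + δ₃ / (1 - δ₂) + ‖tv D‖ / σmin) * ‖tv D‖ := by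
      have hinv : 0 ≤ 1 / (1 - δ₂) := by positivity
      have hinv2 : 0 ≤ δ₂ / (1 - δ₂) := by positivity
      have t1 : ‖tv (fun k => (1 - α l k) • P D k)‖ ≤ δ₂ / (1 - δ₂) * ‖tv D‖ := by
        refine (tv_norm_le _ (P D) _ hinv2 fun k => ?_).trans (by gcongr)
        rw [fnorm_smul]
        exact mul_le_mul_of_nonneg_right (hαb l k).2 (fnorm_nonneg _)
      have t2 : ‖tv (fun k => α l k • R1 k)‖ ≤ 1 / (1 - δ₂) * (δ₂ * ‖tv D‖) := by
        refine (tv_norm_le _ R1 _ hinv fun k => ?_).trans (by gcongr)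
        rw [fnorm_smul]
        exact mul_le_mul_of_nonneg_right (hαb l k).1 (fnorm_nonneg _)
      have t3 : ‖tv (fun k => α l k • R2 k)‖ ≤ 1 / (1 - δ₂) * (δ₃ * ‖tv D‖) := by
        refine (tv_norm_le _ R2 _ hinv fun k => ?_).trans (by gcongr)
        rw [fnorm_smul]
        exact mul_le_mul_of_nonneg_right (hαb l k).1 (fnorm_nonneg _)
      rw [hWX, map_sub, map_add, map_add]
      refine (norm_sub_le _ _).trans ?_
      refine (add_le_add (norm_add₃_le) le_rfl).trans ?_
      refine (add_le_add (add_le_add (add_le_add t1 t2) hNn2) t3).trans (le_of_eq ?_)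
      ring
    have hfin : ‖tv (Xl (l + 1) - X)‖ ≤ 2 * ‖tv (W - X)‖ := by
      refine tv_norm_le _ _ 2 (by norm_num) fun k => ?_
      have h1 := (hNext l k).2 (X k) (hrX k)
      have h2 := fnorm_tri (Xl (l + 1) k) (W k) (X k)
      have h3 := fnorm_sub_comm (X k) (W k)
      simp only [Pi.sub_apply]
      change fnorm (Xl (l + 1) k - W k) ≤ fnorm (X k - W k) at h1
      linarith
    calc _ ≤ 2 * ‖tv (W - X)‖ := hfin
      _ ≤ 2 * ((2 * δ₂ / (1 - δ₂) + δ₃ / (1 - δ₂) + ‖tv D‖ / σmin) * ‖tv D‖) := by gcongr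
      _ = _ := by ring
  have hstep2 : ∀ l, ‖tv (Xl l - X)‖ ≤ 2 * δ₃ * Real.sqrt (r * s) * σmax →
      ‖tv (Xl (l + 1) - X)‖ ≤ 2 * (2 * δ₂ / (1 - δ₂) + δ₃ / (1 - δ₂) +
        2 * δ₃ * Real.sqrt (r * s) * (σmax / σmin)) * ‖tv (Xl l - X)‖ := by
    intro l hl
    refine (hstep l).trans ?_
    have : ‖tv (Xl l - X)‖ / σmin ≤ 2 * δ₃ * Real.sqrt (r * s) * (σmax / σmin) := by
      rw [← mul_div_assoc]
      gcongr
    gcongr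
  have hall : ∀ l, ‖tv (Xl l - X)‖ ≤ 2 * δ₃ * Real.sqrt (r * s) * σmax := by
    intro l
    induction l with
    | zero => exact hinit
    | succ l ih =>
      refine (hstep2 l ih).trans (le_trans ?_ ih)
      exact mul_le_of_le_one_left (norm_nonneg _) hγ.le
  intro l
  have h := hstep2 l (hall l)
  rw [tv_norm, tv_norm] at h
  exact h
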